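/- Let π: L(p) → L(q) be an admissible homomorphism with nonzero kernel. Then, up to a permutation of the indices, ker π is either (Cyclic type) the cyclic group generated by (p_1/n)x_1 − (p_2/n)x_2 for some n ≥ 2 dividing gcd(p_1, p_2), which has order n, or (Klein type) the group generated by (p_1/2)x_1 − (p_2/2)x_2 and (p_1/2)x_1 − (p_3/2)x_3 with p_1, p_2, p_3 even, which is isomorphic to C_2 × C_2. -/

import Mathlib

open scoped BigOperators

def stringRelators {ι : Type} [DecidableEq ι] (p : ι → ℕ) : Set (ι → ℤ) :=
  { v | ∃ i j : ι, v = (p i : ℤ) • Pi.single i 1 - (p j : ℤ) • Pi.single j 1 }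

abbrev StringGroup {ι : Type} [DecidableEq ι] (p : ι → ℕ) : Type :=
  (ι → ℤ) ⧸ AddSubgroup.closure (stringRelators p)

def xgen {ι : Type} [DecidableEq ι] (p : ι → ℕ) (i : ι) : StringGroup p :=
  QuotientAddGroup.mk (Pi.single i 1)

def canon {ι : Type} [DecidableEq ι] (p : ι → ℕ) (i : ι) : StringGroup p :=
  (p i : ℤ) • xgen p i

def IsEffective {κ : Type} [DecidableEq κ] (q : κ → ℕ) (H : AddSubgroup (StringGroup q)) : Prop :=
  ∀ j : κ, ∀ ρ : StringGroup q →+ ZMod (q j),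
    (∀ k, ρ (xgen q k) = if k = j then 1 else 0) →
    ∀ y : ZMod (q j), ∃ x ∈ H, ρ x = y

def Admissible {ι κ : Type} [DecidableEq ι] [DecidableEq κ]
    (p : ι → ℕ) (q : κ → ℕ)
    (multp : StringGroup p → ℕ) (multq : StringGroup q → ℕ)
    (π : StringGroup p →+ StringGroup q) : Prop :=
  IsEffective q π.range ∧
  ∀ z ∈ Set.range π, (∑ᶠ x ∈ π ⁻¹' {z}, multp x) = multq z



lemma sum_zsmul_aux {ι A : Type} [Fintype ι] [AddCommGroup A] (f : ι → ℤ) (c : A) :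
    (∑ i, f i) • c = ∑ i, f i • c := Finset.sum_smul

lemma sg_lift {ι : Type} [DecidableEq ι] [Fintype ι] (p : ι → ℕ) {A : Type} [AddCommGroup A]
    (a : ι → A) (h : ∀ i j, p i • a i = p j • a j) :
    ∃ f : StringGroup p →+ A, ∀ i, f (xgen p i) = a i := by
  let g : (ι → ℤ) →+ A :=
    { toFun := fun v => ∑ i, v i • a i
      map_zero' := by simp
      map_add' := by intro x y; simp [add_smul, Finset.sum_add_distrib] }
  have hg : ∀ i, g (Pi.single i 1) = a i := by
    intro i
    change ∑ j, (Pi.single i (1 : ℤ) : ι → ℤ) j • a j = a i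
    rw [Finset.sum_eq_single i]
    · simp
    · intro j _ hj; simp [Pi.single_eq_of_ne hj]
    · simp
  have hle : AddSubgroup.closure (stringRelators p) ≤ g.ker := by
    rw [AddSubgroup.closure_le]
    rintro v ⟨i, j, rfl⟩
    change g _ = 0
    rw [map_sub, map_zsmul, map_zsmul, hg, hg, natCast_zsmul, natCast_zsmul, h i j, sub_self]
  exact ⟨QuotientAddGroup.lift _ g hle, fun i => hg i⟩

lemma sg_canon {ι : Type} [DecidableEq ι] (p : ι → ℕ) (i j : ι) :
    canon p i = canon p j := by
  unfold canon xgen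
  rw [← QuotientAddGroup.mk_zsmul, ← QuotientAddGroup.mk_zsmul, QuotientAddGroup.eq]
  apply AddSubgroup.subset_closure
  exact ⟨j, i, by abel⟩

lemma sg_mk {ι : Type} [DecidableEq ι] [Fintype ι] (p : ι → ℕ) (x : StringGroup p) :
    ∃ v : ι → ℤ, x = ∑ i, v i • xgen p i := by
  obtain ⟨v, rfl⟩ := QuotientAddGroup.mk_surjective x
  refine ⟨v, ?_⟩
  have : v = ∑ i, v i • (Pi.single i (1 : ℤ) : ι → ℤ) := by
    ext j
    simp [Finset.sum_apply, Pi.single_apply]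
  conv_lhs => rw [this]
  simp only [xgen, ← QuotientAddGroup.mk_zsmul]
  exact map_sum (QuotientAddGroup.mk' (AddSubgroup.closure (stringRelators p))) _ _

lemma sg_data {t : ℕ} (p : Fin (t+1) → ℕ) (hp : ∀ i, 2 ≤ p i) :
    ∃ (d : StringGroup p →+ ℚ) (ρ : ∀ i, StringGroup p →+ ZMod (p i)),
      (∀ i, d (xgen p i) = 1 / p i) ∧
      (∀ i j, ρ i (xgen p j) = if j = i then 1 else 0) ∧
      ∀ x, ∃ m : ℤ, (m : ℚ) = d x - ∑ i, ((ρ i x).val : ℚ) / p i ∧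
        x = ∑ i, ((ρ i x).val : ℤ) • xgen p i + m • canon p 0 := by
  have hp0 : ∀ i, (p i : ℚ) ≠ 0 := fun i => by have := hp i; positivity
  have : ∀ i, NeZero (p i) := fun i => ⟨by have := hp i; omega⟩
  obtain ⟨d, hd⟩ := sg_lift p (fun i => (1 : ℚ) / p i) (by
    intro i j
    simp [hp0])
  have : ∀ i, ∃ f : StringGroup p →+ ZMod (p i), ∀ j, f (xgen p j) = if j = i then 1 else 0 := by
    intro i
    apply sg_lift p
    intro j k
    have : ∀ j, p j • (if j = i then (1 : ZMod (p i)) else 0) = 0 := by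
      intro j
      split_ifs with h
      · subst h; simp
      · simp
    rw [this, this]
  choose ρ hρ using this
  refine ⟨d, ρ, hd, hρ, ?_⟩
  intro x
  obtain ⟨v, hv⟩ := sg_mk p x
  have hr : ∀ i, ((ρ i x).val : ℤ) = v i % p i := by
    intro i
    have : ρ i x = (v i : ZMod (p i)) := by
      rw [hv, map_sum]
      simp [hρ]
    rw [this, ZMod.val_intCast]
  have hx : x = ∑ i, ((ρ i x).val : ℤ) • xgen p i + (∑ i, v i / p i) • canon p 0 := by
    have e : (∑ i, v i / p i) • canon p 0 = ∑ i, (v i / (p i : ℤ)) • canon p 0 := sum_zsmul_aux _ _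
    rw [e, ← Finset.sum_add_distrib]
    conv_lhs => rw [hv]
    refine Finset.sum_congr rfl fun i _ => ?_
    rw [hr, sg_canon p 0 i, canon, smul_smul, ← add_zsmul]
    congr 1
    rw [mul_comm]; exact (Int.emod_add_mul_ediv _ _).symm
  refine ⟨_, ?_, hx⟩
  have h2 := congrArg d hx
  rw [map_add, map_sum, map_zsmul, canon, map_zsmul, hd] at h2
  simp only [map_zsmul, hd] at h2
  rw [h2]
  have h0 := hp0 0
  have : ∀ i, ((ρ i x).val : ℤ) • (1 / (p i : ℚ)) = ((ρ i x).val : ℚ) / p i := by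
    intro i; simp [div_eq_mul_inv]
  simp only [this]
  simp [h0]

lemma zmod_two_tor {n : ℕ} [NeZero n] (a : ZMod n) (ha : a ≠ 0) (h : a + a = 0) :
    2 ∣ n ∧ a = ((n / 2 : ℕ) : ZMod n) := by
  have h1 := ZMod.val_lt a
  have h2 : a.val ≠ 0 := by rwa [Ne, ZMod.val_eq_zero]
  have h3 : n ∣ a.val + a.val := by
    rw [← ZMod.natCast_eq_zero_iff]; push_cast; rw [ZMod.natCast_zmod_val]; exact h
  have h4 : a.val + a.val = n := by
    obtain ⟨c, hc⟩ := h3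
    have : c = 1 := by
      have : c < 2 := by nlinarith
      have : c ≠ 0 := by rintro rfl; omega
      omega
    subst this; omega
  refine ⟨⟨a.val, by omega⟩, ?_⟩
  have : n / 2 = a.val := by omega
  rw [this, ZMod.natCast_zmod_val]

lemma zmod_val_neg {n : ℕ} [NeZero n] (a : ZMod n) :
    (a.val : ℚ) / n + ((-a).val : ℚ) / n = if a = 0 then 0 else 1 := by
  have hn : (n : ℚ) ≠ 0 := by exact_mod_cast NeZero.ne n
  have h1 := ZMod.val_lt a
  rw [ZMod.neg_val]
  split_ifs with h
  · simp [h]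
  · rw [Nat.cast_sub h1.le]; field_simp; ring

set_option maxHeartbeats 1000000 in
/-- The key combinatorial fact: kernel is finite of degree zero, and every nonzero element
has exactly two nonzero residues. -/
lemma ker_supp {t s : ℕ} (p : Fin (t+1) → ℕ) (q : Fin (s+1) → ℕ)
    (hp : ∀ i, 2 ≤ p i) (hq : ∀ j, 2 ≤ q j)
    (multp : StringGroup p → ℕ) (multq : StringGroup q → ℕ)
    (hmultp : ∀ (l : Fin (t+1) → ℤ) (m : ℤ), (∀ i, 0 ≤ l i ∧ l i < (p i : ℤ)) →
      multp (∑ i, l i • xgen p i + m • canon p 0) = (m + 1).toNat)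
    (hmultq : ∀ (l : Fin (s+1) → ℤ) (m : ℤ), (∀ j, 0 ≤ l j ∧ l j < (q j : ℤ)) →
      multq (∑ j, l j • xgen q j + m • canon q 0) = (m + 1).toNat)
    (π : StringGroup p →+ StringGroup q)
    (hadm : Admissible p q multp multq π) :
    ∃ (d : StringGroup p →+ ℚ) (ρ : ∀ i, StringGroup p →+ ZMod (p i)),
      (∀ i, d (xgen p i) = 1 / p i) ∧
      (∀ i j, ρ i (xgen p j) = if j = i then 1 else 0) ∧
      (∀ x, d x = 0 → ∀ j, (∀ i, i ≠ j → ρ i x = 0) → x = 0) ∧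
      (∀ x ∈ π.ker, d x = 0) ∧ Finite π.ker ∧
      (∀ x ∈ π.ker, x ≠ 0 → (Finset.univ.filter (fun i => ρ i x ≠ 0)).card = 2) := by
  classical
  obtain ⟨d, ρ, hd, hρ, hnf⟩ := sg_data p hp
  obtain ⟨d', ρ', hd', hρ', hnf'⟩ := sg_data q hq
  have hp0 : ∀ i, (p i : ℚ) ≠ 0 := fun i => by have := hp i; positivity
  have : ∀ i, NeZero (p i) := fun i => ⟨by have := hp i; omega⟩
  have : ∀ i, NeZero (q i) := fun i => ⟨by have := hq i; omega⟩
  have hdc : d (canon p 0) = 1 := by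
    have := hp0 0
    rw [canon, map_zsmul, hd]; simp [this]
  have hρc : ∀ i, ρ i (canon p 0) = 0 := by
    intro i
    rw [sg_canon p 0 i, canon, map_zsmul, hρ]; simp
  have hinj : ∀ x, d x = 0 → ∀ j, (∀ i, i ≠ j → ρ i x = 0) → x = 0 := by
    intro x hx j hj
    obtain ⟨m, hm, hxm⟩ := hnf x
    have hs : ∑ i, ((ρ i x).val : ℚ) / p i = ((ρ j x).val : ℚ) / p j := by
      apply Finset.sum_eq_single j
      · intro i _ hi; simp [hj i hi]
      · simp
    rw [hs, hx] at hm
    have h1 := ZMod.val_lt (ρ j x)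
    have hpj := hp0 j
    have h2 : m * (p j : ℤ) = - ((ρ j x).val : ℤ) := by
      have : (m : ℚ) * p j = - (ρ j x).val := by rw [hm]; field_simp; ring
      exact_mod_cast this
    have hm0 : m = 0 := by
      have : (0 : ℤ) < p j := by have := hp j; omega
      have a1 : m ≤ 0 := by nlinarith
      have a2 : -1 < m := by nlinarith
      omega
    subst hm0
    have h3 : (ρ j x).val = 0 := by omega
    rw [hxm]
    simp only [zero_smul, add_zero]
    apply Finset.sum_eq_zero
    intro i _
    by_cases hi : i = j
    · subst hi; simp [h3]
    · simp [hj i hi]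
  have hmult : ∀ x, ∀ m : ℤ, (m : ℚ) = d x - ∑ i, ((ρ i x).val : ℚ) / p i →
      multp x = (m + 1).toNat := by
    intro x m hm
    obtain ⟨m', hm', hxm⟩ := hnf x
    have : m' = m := by exact_mod_cast hm'.trans hm.symm
    subst this
    conv_lhs => rw [hxm]
    apply hmultp
    intro i
    exact ⟨by positivity, by exact_mod_cast ZMod.val_lt _⟩
  have hmultpc : ∀ m : ℤ, multp (m • canon p 0) = (m + 1).toNat := by
    intro m
    have := hmultp 0 m (fun i => ⟨le_rfl, by have := hp i; simp; omega⟩)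
    simpa using this
  have hmultqc : ∀ m : ℤ, multq (m • canon q 0) = (m + 1).toNat := by
    intro m
    have := hmultq 0 m (fun i => ⟨le_rfl, by have := hq i; simp; omega⟩)
    simpa using this
  -- powers
  have hPp : ∀ x, (∀ i, ρ i x = 0) → ∃ m : ℤ, (m : ℚ) = d x ∧ x = m • canon p 0 := by
    intro x hx
    obtain ⟨m, hm, hxm⟩ := hnf x
    simp only [hx] at hm hxm
    exact ⟨m, by simpa using hm, by simpa using hxm⟩
  have hPq : ∀ x, (∀ i, ρ' i x = 0) → ∃ m : ℤ, x = m • canon q 0 := by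
    intro x hx
    obtain ⟨m, hm, hxm⟩ := hnf' x
    simp only [hx] at hm hxm
    exact ⟨m, by simpa using hxm⟩
  -- no elements of nonzero degree
  have hdeg : ∀ x ∈ π.ker, d x = 0 := by
    intro x hx
    by_contra hne
    obtain ⟨m, hm, hxm⟩ := hPp ((∏ i, p i) • x) (by
      intro i
      rw [map_nsmul, nsmul_eq_mul, (ZMod.natCast_eq_zero_iff _ _).2
        (Finset.dvd_prod_of_mem p (Finset.mem_univ i)), zero_mul])
    have hm0 : m ≠ 0 := by
      intro h
      rw [h, map_nsmul, nsmul_eq_mul] at hm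
      have : ((∏ i, p i : ℕ) : ℚ) ≠ 0 := by
        push_cast; exact Finset.prod_ne_zero_iff.2 fun i _ => hp0 i
      simp [hne] at hm
      simp_all
    have hmk : m • canon p 0 ∈ π.ker := by rw [← hxm]; exact π.ker.nsmul_mem hx _
    have h0 := hadm.2 0 ⟨0, map_zero π⟩
    have hq0 : multq 0 = 1 := by simpa using hmultqc 0
    rw [hq0, finsum_mem_eq_zero_of_infinite] at h0
    · exact one_ne_zero h0.symm
    · have : Set.Infinite (Set.range (fun r : ℕ => ((r : ℤ) * |m|) • canon p 0)) := by
        apply Set.infinite_range_of_injective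
        intro a b hab
        have := congrArg d hab
        simp only [map_zsmul, hdc] at this
        have hab' : ((a : ℤ) * |m|) = (b : ℤ) * |m| := by
          simp only [zsmul_eq_mul, mul_one] at this
          exact_mod_cast this
        have := mul_right_cancel₀ (abs_ne_zero.2 hm0) hab'
        exact_mod_cast this
      refine this.mono ?_
      rintro _ ⟨r, rfl⟩
      refine ⟨?_, ?_⟩
      · change ((r : ℤ) * |m|) • canon p 0 ∈ π.ker
        rw [mul_smul]
        apply AddSubgroup.zsmul_mem
        rcases abs_choice m with h | h <;> rw [h]
        · exact hmk
        · rw [neg_smul]; exact π.ker.neg_mem hmk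
      · rw [Function.mem_support]
        rw [hmultpc]
        have : 0 ≤ (r : ℤ) * |m| := by positivity
        omega
  have hfin : Finite π.ker := by
    apply Finite.of_injective (fun (k : π.ker) (i : Fin (t+1)) => ρ i k)
    intro a b hab
    apply Subtype.ext
    rw [← sub_eq_zero]
    apply hinj _ _ 0
    · intro i _
      rw [map_sub, sub_eq_zero]
      exact congrFun hab i
    · exact hdeg _ (π.ker.sub_mem a.2 b.2)
  refine ⟨d, ρ, hd, hρ, hinj, hdeg, hfin, ?_⟩
  have : Fintype π.ker := Fintype.ofFinite _
  -- the m_k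
  have hmk : ∀ k : π.ker, ∃ m : ℤ, (m : ℚ) = - ∑ i, ((ρ i k).val : ℚ) / p i := by
    intro k
    obtain ⟨m, hm, -⟩ := hnf k
    exact ⟨m, by rw [hm, hdeg k k.2, zero_sub]⟩
  choose μ hμ using hmk
  have hμlb : ∀ k, -((t : ℤ) + 1) ≤ μ k := by
    intro k
    have : ∑ i, ((ρ i k).val : ℚ) / p i ≤ ∑ i : Fin (t+1), 1 := by
      apply Finset.sum_le_sum
      intro i _
      rw [div_le_one (by have := hp i; positivity)]
      exact_mod_cast (ZMod.val_lt _).le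
    simp only [Finset.sum_const, Finset.card_univ, Fintype.card_fin, nsmul_eq_mul, mul_one] at this
    push_cast at this
    have h2 : -((t : ℚ) + 1) ≤ μ k := by rw [hμ]; linarith
    exact_mod_cast h2
  have hsumN : ∀ N : ℕ, t + 1 ≤ N →
      ((multq (π ((N : ℤ) • canon p 0)) : ℕ) : ℤ) = ∑ k : π.ker, ((N : ℤ) + μ k + 1) := by
    intro N hN
    rw [← hadm.2 _ ⟨_, rfl⟩]
    have : π ⁻¹' {π ((N : ℤ) • canon p 0)} =
        Set.range (fun k : π.ker => (N : ℤ) • canon p 0 + (k : StringGroup p)) := by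
      ext x
      constructor
      · intro hx
        refine ⟨⟨x - (N : ℤ) • canon p 0, ?_⟩, by simp⟩
        rw [AddMonoidHom.mem_ker, map_sub, sub_eq_zero]
        exact hx
      · rintro ⟨k, rfl⟩
        have : π (k : StringGroup p) = 0 := k.2
        simp [this]
    rw [this, finsum_mem_range, finsum_eq_sum_of_fintype]
    · push_cast
      apply Finset.sum_congr rfl
      intro k _
      rw [hmult _ ((N : ℤ) + μ k)]
      · have := hμlb k; omega
      · push_cast
        rw [hμ, map_add, map_zsmul, hdc, hdeg k k.2]
        simp only [map_add, map_zsmul, hρc, smul_zero, zero_add]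
        simp
        ring
    · intro a b hab
      exact Subtype.ext (add_left_cancel hab)
  obtain ⟨M, hM⟩ := hPq ((∏ i, q i) • π (canon p 0)) (by
      intro i
      rw [map_nsmul, nsmul_eq_mul, (ZMod.natCast_eq_zero_iff _ _).2
        (Finset.dvd_prod_of_mem q (Finset.mem_univ i)), zero_mul])
  have hQ : 1 ≤ ∏ i, q i := Finset.one_le_prod' fun i _ => by have := hq i; omega
  set Q := ∏ i, q i with hQdef
  set n : ℤ := ((Fintype.card π.ker : ℕ) : ℤ) with hn
  have hn1 : 1 ≤ n := by
    have : 0 < Fintype.card π.ker := Fintype.card_pos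
    omega
  have hsum2 : ∀ r : ℕ, t + 1 ≤ r → max ((r : ℤ) * M + 1) 0 = n * (r * Q + 1) + ∑ k, μ k := by
    intro r hr
    have := hsumN (r * Q) (by nlinarith)
    have e : π (((r * Q : ℕ) : ℤ) • canon p 0) = ((r : ℤ) * M) • canon q 0 := by
      rw [map_zsmul, mul_smul, ← hM, natCast_zsmul, natCast_zsmul, mul_smul]
    rw [e, hmultqc, Int.toNat_eq_max] at this
    rw [this, hn]
    simp only [Finset.sum_add_distrib, Finset.sum_const, Finset.card_univ, nsmul_eq_mul]
    push_cast; ring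
  have hS : ∑ k, μ k = 1 - n := by
    have h1 := hsum2 (t+1) (by omega)
    have h2 := hsum2 (t+2) (by omega)
    have h3 := hsum2 (t+3) (by omega)
    have hQ' : (1 : ℤ) ≤ Q := by exact_mod_cast hQ
    have hnQ : 1 ≤ n * Q := by nlinarith
    push_cast at h1 h2 h3
    have ht : (0 : ℤ) ≤ t := by positivity
    rcases le_or_gt M 0 with hM0 | hM0
    · exfalso
      have a1 : 0 ≤ max (((t : ℤ) + 1) * M + 1) 0 := le_max_right _ _
      have a3 : max (((t : ℤ) + 3) * M + 1) 0 ≤ 1 := by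
        apply max_le _ (by norm_num); nlinarith
      nlinarith
    · rw [max_eq_left (by positivity)] at h1 h2
      have : M = n * Q := by linarith
      rw [this] at h1
      linarith
  -- count
  let c : π.ker → ℕ := fun k => (Finset.univ.filter (fun i => ρ i (k : StringGroup p) ≠ 0)).card
  have hc : ∀ k, (c k : ℤ) = - (μ k + μ (-k)) := by
    intro k
    have : (c k : ℚ) = - (μ k + μ (-k)) := by
      rw [hμ, hμ]
      have : ∑ i, (((ρ i k).val : ℚ) / p i + ((ρ i (-k : π.ker)).val : ℚ) / p i)
          = ∑ i, if ρ i k ≠ 0 then (1 : ℚ) else 0 := by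
        apply Finset.sum_congr rfl
        intro i _
        have h := zmod_val_neg (ρ i k)
        simp only [AddSubgroup.coe_neg, map_neg]
        rw [h]
        split_ifs <;> simp_all
      rw [Finset.sum_boole, Finset.sum_add_distrib] at this
      simp only [c]
      linarith
    exact_mod_cast this
  have hcs : ∑ k, (c k : ℤ) = 2 * (n - 1) := by
    simp only [hc, Finset.sum_neg_distrib, Finset.sum_add_distrib]
    have : ∑ k : π.ker, μ (-k) = ∑ k, μ k := Equiv.sum_comp (Equiv.neg π.ker) μ
    rw [this, hS]; ring
  have hc2 : ∀ k, k ≠ 0 → 2 ≤ c k := by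
    intro k hk
    by_contra hlt
    have h1 : c k ≤ 1 := by omega
    rw [Finset.card_le_one_iff_subset_singleton] at h1
    obtain ⟨j, hj⟩ := h1
    apply hk
    apply Subtype.ext
    apply hinj _ (hdeg k k.2) j
    intro i hi
    by_contra h
    exact hi (by simpa using hj (by simpa using h : i ∈ Finset.univ.filter _))
  have hle : ∀ k ∈ Finset.univ, (if k = 0 then 0 else 2 : ℤ) ≤ c k := by
    intro k _
    split_ifs with h
    · positivity
    · exact_mod_cast hc2 k h
  have heq : ∑ k : π.ker, (if k = 0 then 0 else 2 : ℤ) = ∑ k, (c k : ℤ) := by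
    rw [hcs]
    have : ∀ k : π.ker, (if k = 0 then 0 else 2 : ℤ) = 2 - if k = 0 then 2 else 0 := by
      intro k; split_ifs <;> simp
    simp only [this, Finset.sum_sub_distrib, Finset.sum_ite_eq', Finset.mem_univ, if_true,
      Finset.sum_const, Finset.card_univ, nsmul_eq_mul]
    rw [hn]; ring
  intro x hx hx0
  have := (Finset.sum_eq_sum_iff_of_le hle).1 heq ⟨x, hx⟩ (Finset.mem_univ _)
  rw [if_neg (by simpa using hx0)] at this
  exact_mod_cast this.symm


/-- Klein case. -/
lemma klein_case {T : ℕ} (p : Fin T → ℕ) (hp : ∀ i, 2 ≤ p i) {A : Type} [AddCommGroup A]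
    (x : Fin T → A) (d : A →+ ℚ) (ρ : ∀ i, A →+ ZMod (p i))
    (hd : ∀ i, d (x i) = 1 / p i) (hρ : ∀ i j, ρ i (x j) = if j = i then 1 else 0)
    (hinj : ∀ x, d x = 0 → ∀ j, (∀ i, i ≠ j → ρ i x = 0) → x = 0)
    (K : AddSubgroup A) (hK : ∀ x ∈ K, d x = 0)
    (h3 : ∀ x ∈ K, ∀ a b c, a ≠ b → a ≠ c → b ≠ c → ρ a x ≠ 0 → ρ b x ≠ 0 → ρ c x = 0)
    (i j l : Fin T) (hij : i ≠ j) (hil : i ≠ l) (hjl : j ≠ l)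
    (u v : A) (hu : u ∈ K) (hv : v ∈ K) (hui : ρ i u ≠ 0) (huj : ρ j u ≠ 0)
    (hvi : ρ i v ≠ 0) (hvl : ρ l v ≠ 0) :
    2 ∣ p i ∧ 2 ∣ p j ∧ 2 ∣ p l ∧
      K = AddSubgroup.closure
        {(p i / 2) • x i - (p j / 2) • x j, (p i / 2) • x i - (p l / 2) • x l} ∧
      Nonempty (K ≃+ ZMod 2 × ZMod 2) := by
  have hne : ∀ i, NeZero (p i) := fun i => ⟨by have := hp i; omega⟩
  -- two-torsion
  have key : ∀ (j l : Fin T), i ≠ j → i ≠ l → j ≠ l → ∀ u ∈ K, ∀ v ∈ K, ρ i u ≠ 0 → ρ j u ≠ 0 →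
      ρ i v ≠ 0 → ρ l v ≠ 0 → ρ i u + ρ i u = 0 := by
    intro j l hij hil hjl u hu v hv hui huj hvi hvl
    have hul : ρ l u = 0 := h3 u hu i j l hij hil hjl hui huj
    have hvj : ρ j v = 0 := h3 v hv i l j hil hij hjl.symm hvi hvl
    have e1 := h3 (u + v) (K.add_mem hu hv) j l i hjl hij.symm hil.symm
      (by simpa [hvj] using huj) (by simpa [hul] using hvl)
    have e2 := h3 (u - v) (K.sub_mem hu hv) j l i hjl hij.symm hil.symm
      (by simpa [hvj] using huj) (by simpa [hul] using hvl)
    rw [map_add] at e1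
    rw [map_sub, sub_eq_zero] at e2
    rw [← e2] at e1
    exact e1
  have key2 : ∀ (j l : Fin T), i ≠ j → i ≠ l → j ≠ l → ∀ u ∈ K, ∀ v ∈ K, ρ i u ≠ 0 → ρ j u ≠ 0 →
      ρ i v ≠ 0 → ρ l v ≠ 0 → 2 ∣ p i ∧ 2 ∣ p j ∧ u + u = 0 ∧
        u = (p i / 2) • x i - (p j / 2) • x j := by
    intro j l hij hil hjl u hu v hv hui huj hvi hvl
    have e := key j l hij hil hjl u hu v hv hui huj hvi hvl
    obtain ⟨a1, a2⟩ := zmod_two_tor _ hui e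
    have uz : ∀ m, m ≠ i → m ≠ j → ρ m u = 0 := fun m hmi hmj =>
      h3 u hu i j m hij hmi.symm hmj.symm hui huj
    have huu : u + u = 0 := by
      apply hinj _ (hK _ (K.add_mem hu hu)) j
      intro m hm
      rw [map_add]
      by_cases hmi : m = i
      · subst hmi; exact e
      · rw [uz m hmi hm, add_zero]
    obtain ⟨b1, b2⟩ := zmod_two_tor _ huj (by rw [← map_add, huu, map_zero])
    refine ⟨a1, b1, huu, ?_⟩
    rw [← sub_eq_zero]
    apply hinj _ _ j
    · intro m hm
      by_cases hmi : m = i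
      · subst hmi
        simp [hρ, hm.symm, a2]
      · simp [hρ, uz m hmi hm, hm.symm, Ne.symm hmi]
    · have pi0 : (p i : ℚ) ≠ 0 := by have := hp i; positivity
      have pj0 : (p j : ℚ) ≠ 0 := by have := hp j; positivity
      simp only [map_sub, map_nsmul, hd, hK u hu, nsmul_eq_mul]
      rw [Nat.cast_div a1 (by norm_num), Nat.cast_div b1 (by norm_num)]
      field_simp
      ring
  obtain ⟨pi2, pj2, huu, hu'⟩ := key2 j l hij hil hjl u hu v hv hui huj hvi hvl
  obtain ⟨-, pl2, hvv, hv'⟩ := key2 l j hil hij hjl.symm v hv u hu hvi hvl hui huj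
  have hul : ρ l u = 0 := h3 u hu i j l hij hil hjl hui huj
  have hvj : ρ j v = 0 := h3 v hv i l j hil hij hjl.symm hvi hvl
  have hm0 : ∀ w ∈ K, ∀ m, m ≠ i → m ≠ j → m ≠ l → ρ m w = 0 := by
    intro w hw m hmi hmj hml
    by_contra hm
    have hmu := h3 u hu i j m hij hmi.symm hmj.symm hui huj
    have hmv := h3 v hv i l m hil hmi.symm hml.symm hvi hvl
    by_cases hj : ρ j w = 0
    · by_cases hl : ρ l w = 0
      · have := h3 (w + (u + v)) (K.add_mem hw (K.add_mem hu hv)) m j l hmj hml hjl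
          (by simpa [hmu, hmv] using hm) (by simpa [hj, hvj] using huj)
        simp [hl, hul, hvl] at this
      · have hi := h3 w hw m l i hml hmi hil.symm hm hl
        have := h3 (w + u) (K.add_mem hw hu) m i j hmi hmj hij
          (by simpa [hmu] using hm) (by simpa [hi] using hui)
        simp [hj, huj] at this
    · have hi := h3 w hw m j i hmj hmi hij.symm hm hj
      have hl := h3 w hw m j l hmj hml hjl hm hj
      have := h3 (w + v) (K.add_mem hw hv) m i l hmi hml hil
          (by simpa [hmv] using hm) (by simpa [hi] using hvi)
      simp [hl, hvl] at this
  have hcase : ∀ w ∈ K, ρ j w = 0 → w = 0 ∨ w = v := by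
    intro w hw hj
    by_cases hi : ρ i w = 0
    · left
      apply hinj _ (hK _ hw) l
      intro m hm
      by_cases hmi : m = i
      · subst hmi; exact hi
      by_cases hmj : m = j
      · subst hmj; exact hj
      exact hm0 w hw m hmi hmj hm
    · by_cases hl : ρ l w = 0
      · left
        apply hinj _ (hK _ hw) i
        intro m hm
        by_cases hml : m = l
        · subst hml; exact hl
        by_cases hmj : m = j
        · subst hmj; exact hj
        exact hm0 w hw m hm hmj hml
      · right
        rw [(key2 l j hil hij hjl.symm w hw u hu hi hl hui huj).2.2.2, ← hv']
  have hcase2 : ∀ w ∈ K, ρ l w = 0 → w = 0 ∨ w = u := by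
    intro w hw hl
    by_cases hj : ρ j w = 0
    · rcases hcase w hw hj with h | h
      · exact Or.inl h
      · rw [h] at hl; exact absurd hl hvl
    by_cases hi : ρ i w = 0
    · left
      apply hinj _ (hK _ hw) j
      intro m hm
      by_cases hmi : m = i
      · subst hmi; exact hi
      by_cases hml : m = l
      · subst hml; exact hl
      exact hm0 w hw m hmi hm hml
    · right
      rw [(key2 j l hij hil hjl w hw v hv hi hj hvi hvl).2.2.2, ← hu']
  have hall : ∀ w ∈ K, w = 0 ∨ w = u ∨ w = v ∨ w = u + v := by
    intro w hw
    by_cases hj : ρ j w = 0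
    · rcases hcase w hw hj with h | h <;> simp [h]
    by_cases hl : ρ l w = 0
    · rcases hcase2 w hw hl with h | h <;> simp [h]
    have hi := h3 w hw j l i hjl hij.symm hil.symm hj hl
    have := h3 (w - u) (K.sub_mem hw hu) i l j hil hij hjl.symm (by simpa [hi] using hui)
      (by simpa [hul] using hl)
    rcases hcase (w - u) (K.sub_mem hw hu) this with h | h
    · rw [sub_eq_zero] at h; simp [h]
    · rw [sub_eq_iff_eq_add] at h; simp [h, add_comm]
  refine ⟨pi2, pj2, pl2, ?_, ?_⟩
  · rw [← hu', ← hv']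
    apply le_antisymm
    · intro w hw
      have hu1 : u ∈ AddSubgroup.closure {u, v} := AddSubgroup.subset_closure (by simp)
      have hv1 : v ∈ AddSubgroup.closure {u, v} := AddSubgroup.subset_closure (by simp)
      rcases hall w hw with h | h | h | h <;> rw [h]
      · exact AddSubgroup.zero_mem _
      · exact hu1
      · exact hv1
      · exact AddSubgroup.add_mem _ hu1 hv1
    · rw [AddSubgroup.closure_le]
      rintro w (rfl | rfl)
      · exact hu
      · exact hv
  · have hu0 : u ≠ 0 := by rintro rfl; simp at hui
    have hv0 : v ≠ 0 := by rintro rfl; simp at hvi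
    have huv : u ≠ v := by rintro rfl; exact huj hvj
    have huv0 : u + v ≠ 0 := by
      intro h
      have := congrArg (ρ j) h
      simp [hvj] at this
      exact huj this
    have hcard : Nat.card K = 4 := by
      have : (K : Set A) = {0, u, v, u + v} := by
        ext w
        constructor
        · intro hw; simpa using hall w hw
        · rintro (rfl | rfl | rfl | rfl)
          · exact K.zero_mem
          · exact hu
          · exact hv
          · exact K.add_mem hu hv
      change Nat.card (K : Set A) = 4
      classical
      rw [this, Nat.card_coe_set_eq]
      have e : ({0, u, v, u + v} : Set A) = (({0, u, v, u + v} : Finset A) : Set A) := by simp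
      rw [e, Set.ncard_coe_finset]
      rw [Finset.card_insert_of_notMem, Finset.card_insert_of_notMem,
        Finset.card_insert_of_notMem, Finset.card_singleton]
      · simp [hu0]
      · simp [huv, hv0]
      · simp [hu0.symm, hv0.symm, huv0.symm]
    have hexp : AddMonoid.exponent K = 2 := by
      have h2 : AddMonoid.exponent K ∣ 2 := by
        apply AddMonoid.exponent_dvd_of_forall_nsmul_eq_zero
        rintro ⟨w, hw⟩
        apply Subtype.ext
        change 2 • w = 0
        rw [two_nsmul]
        rcases hall w hw with h | h | h | h <;> rw [h]
        · simp
        · exact huu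
        · exact hvv
        · rw [add_add_add_comm, huu, hvv, add_zero]
      rcases (Nat.dvd_prime Nat.prime_two).1 h2 with h | h
      · exfalso
        rw [AddMonoid.exp_eq_one_iff] at h
        exact hu0 (congrArg Subtype.val (Subsingleton.elim (⟨u, hu⟩ : K) 0))
      · exact h
    have : IsAddKleinFour K := ⟨hcard, hexp⟩
    exact IsAddKleinFour.nonempty_addEquiv

/-- Cyclic case. -/
lemma cyclic_case {T : ℕ} (p : Fin T → ℕ) (hp : ∀ i, 2 ≤ p i) {A : Type} [AddCommGroup A]
    (x : Fin T → A) (d : A →+ ℚ) (ρ : ∀ i, A →+ ZMod (p i))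
    (hd : ∀ i, d (x i) = 1 / p i) (hρ : ∀ i j, ρ i (x j) = if j = i then 1 else 0)
    (hinj : ∀ x, d x = 0 → ∀ j, (∀ i, i ≠ j → ρ i x = 0) → x = 0)
    (K : AddSubgroup A) (hfin : Finite K) (hK : ∀ x ∈ K, d x = 0) (hbot : K ≠ ⊥)
    (i j : Fin T) (hij : i ≠ j) (h2 : ∀ x ∈ K, ∀ l, l ≠ i → l ≠ j → ρ l x = 0) :
    ∃ n : ℕ, 2 ≤ n ∧ n ∣ Nat.gcd (p i) (p j) ∧
      K = AddSubgroup.zmultiples ((p i / n) • x i - (p j / n) • x j) ∧ Nat.card K = n := by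
  classical
  have hne : ∀ i, NeZero (p i) := fun i => ⟨by have := hp i; omega⟩
  have inj : ∀ i j, (∀ x ∈ K, ∀ l, l ≠ i → l ≠ j → ρ l x = 0) →
      Function.Injective ((ρ i).comp K.subtype) := by
    intro i j h2
    rw [injective_iff_map_eq_zero]
    rintro ⟨w, hw⟩ h
    apply Subtype.ext
    apply hinj w (hK w hw) j
    intro l hl
    by_cases hli : l = i
    · subst hli; exact h
    · exact h2 w hw l hli hl
  have injI := inj i j h2
  have injJ := inj j i (fun x hx l a b => h2 x hx l b a)
  have di : Nat.card K ∣ p i := by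
    simpa using AddSubgroup.card_dvd_of_injective _ injI
  have dj : Nat.card K ∣ p j := by
    simpa using AddSubgroup.card_dvd_of_injective _ injJ
  have hn2 : 2 ≤ Nat.card K := by
    have : Nontrivial K := (AddSubgroup.nontrivial_iff_ne_bot K).2 hbot
    exact Finite.one_lt_card
  refine ⟨Nat.card K, hn2, Nat.dvd_gcd di dj, ?_, rfl⟩
  set n := Nat.card K with hn
  have : Fintype K := Fintype.ofFinite K
  have himg : Finset.univ.image ((ρ i).comp K.subtype) =
      Finset.univ.filter (fun a : ZMod (p i) => n • a = 0) := by
    apply Finset.eq_of_subset_of_card_le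
    · intro a ha
      simp only [Finset.mem_image, Finset.mem_univ, true_and] at ha
      obtain ⟨k, rfl⟩ := ha
      simp only [Finset.mem_filter, Finset.mem_univ, true_and]
      rw [← map_nsmul, hn, card_nsmul_eq_zero', map_zero]
    · rw [Finset.card_image_of_injective _ injI, Finset.card_univ, ← Nat.card_eq_fintype_card]
      exact IsAddCyclic.card_nsmul_eq_zero_le (by omega)
  have hmem : ((p i / n : ℕ) : ZMod (p i)) ∈ Finset.univ.image ((ρ i).comp K.subtype) := by
    rw [himg]
    simp only [Finset.mem_filter, Finset.mem_univ, true_and]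
    rw [nsmul_eq_mul, ← Nat.cast_mul, Nat.mul_div_cancel' di, ZMod.natCast_self]
  simp only [Finset.mem_image, Finset.mem_univ, true_and] at hmem
  obtain ⟨⟨g, hg⟩, hgi⟩ := hmem
  replace hgi : ρ i g = ((p i / n : ℕ) : ZMod (p i)) := hgi
  have hgeq : g = (p i / n) • x i - (p j / n) • x j := by
    rw [← sub_eq_zero]
    apply hinj _ _ j
    · intro m hm
      by_cases hmi : m = i
      · subst hmi
        simp [hρ, hm.symm, hgi]
      · simp [hρ, h2 g hg m hmi hm, hm.symm, Ne.symm hmi]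
    · have pi0 : (p i : ℚ) ≠ 0 := by have := hp i; positivity
      have pj0 : (p j : ℚ) ≠ 0 := by have := hp j; positivity
      have n0 : (n : ℚ) ≠ 0 := by positivity
      simp only [map_sub, map_nsmul, hd, hK g hg, nsmul_eq_mul]
      rw [Nat.cast_div di n0, Nat.cast_div dj n0]
      field_simp
      ring
  rw [← hgeq]
  symm
  apply AddSubgroup.eq_of_le_of_card_ge
  · rw [AddSubgroup.zmultiples_le]; exact hg
  · rw [Nat.card_zmultiples]
    have hpos : 0 < addOrderOf g := by
      have : addOrderOf (⟨g, hg⟩ : K) = addOrderOf g := AddSubgroup.addOrderOf_mk g hg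
      rw [← this]; exact addOrderOf_pos _
    have h0 : addOrderOf g • ρ i g = 0 := by
      rw [← map_nsmul, addOrderOf_nsmul_eq_zero, map_zero]
    rw [hgi, nsmul_eq_mul, ← Nat.cast_mul, ZMod.natCast_eq_zero_iff] at h0
    obtain ⟨e, he⟩ := di
    have hpi := hp i
    have hdiv : p i / n = e := by rw [he]; exact Nat.mul_div_cancel_left _ (by omega)
    rw [hdiv, he] at h0
    have e0 : 0 < e := by
      rcases Nat.eq_zero_or_pos e with h | h
      · rw [h] at he; omega
      · exact h
    exact Nat.le_of_dvd hpos (Nat.dvd_of_mul_dvd_mul_right e0 h0)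

theorem stmt10 {t s : ℕ} (p : Fin (t+1) → ℕ) (q : Fin (s+1) → ℕ)
    (hp : ∀ i, 2 ≤ p i) (hq : ∀ j, 2 ≤ q j)
    (multp : StringGroup p → ℕ) (multq : StringGroup q → ℕ)
    (hmultp : ∀ (l : Fin (t+1) → ℤ) (m : ℤ), (∀ i, 0 ≤ l i ∧ l i < (p i : ℤ)) →
      multp (∑ i, l i • xgen p i + m • canon p 0) = (m + 1).toNat)
    (hmultq : ∀ (l : Fin (s+1) → ℤ) (m : ℤ), (∀ j, 0 ≤ l j ∧ l j < (q j : ℤ)) →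
      multq (∑ j, l j • xgen q j + m • canon q 0) = (m + 1).toNat)
    (π : StringGroup p →+ StringGroup q)
    (hadm : Admissible p q multp multq π)
    (hker : π.ker ≠ ⊥) :
    (∃ (n : ℕ) (i j : Fin (t+1)), i ≠ j ∧ 2 ≤ n ∧ n ∣ Nat.gcd (p i) (p j) ∧
      π.ker = AddSubgroup.zmultiples ((p i / n) • xgen p i - (p j / n) • xgen p j) ∧
      Nat.card π.ker = n) ∨
    (∃ i j k : Fin (t+1), i ≠ j ∧ i ≠ k ∧ j ≠ k ∧
      2 ∣ p i ∧ 2 ∣ p j ∧ 2 ∣ p k ∧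
      π.ker = AddSubgroup.closure
        {(p i / 2) • xgen p i - (p j / 2) • xgen p j,
         (p i / 2) • xgen p i - (p k / 2) • xgen p k} ∧
      Nonempty (π.ker ≃+ ZMod 2 × ZMod 2)) := by
  classical
  obtain ⟨d, ρ, hd, hρ, hinj, hK, hfin, hc⟩ :=
    ker_supp p q hp hq multp multq hmultp hmultq π hadm
  have h3 : ∀ x ∈ π.ker, ∀ a b c, a ≠ b → a ≠ c → b ≠ c → ρ a x ≠ 0 → ρ b x ≠ 0 →
      ρ c x = 0 := by
    intro x hx a b c hab hac hbc ha hb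
    by_contra hcc
    have hx0 : x ≠ 0 := by rintro rfl; simp at ha
    have h2 := hc x hx hx0
    have hsub : ({a, b, c} : Finset (Fin (t+1))) ⊆
        Finset.univ.filter (fun i => ρ i x ≠ 0) := by
      intro m hm
      simp only [Finset.mem_insert, Finset.mem_singleton] at hm
      rcases hm with rfl | rfl | rfl <;> simpa
    have := Finset.card_le_card hsub
    rw [h2, Finset.card_eq_three.2 ⟨a, b, c, hab, hac, hbc, rfl⟩] at this
    omega
  have hpair : ∀ x ∈ π.ker, ∀ a, ρ a x ≠ 0 → ∃ b, a ≠ b ∧ ρ b x ≠ 0 := by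
    intro x hx a ha
    by_contra! h
    have hx0 : x ≠ 0 := by rintro rfl; simp at ha
    exact hx0 (hinj x (hK x hx) a (fun i hi => h i hi.symm))
  obtain ⟨u, hu, hu0⟩ := AddSubgroup.ne_bot_iff_exists_ne_zero.1 hker |>.elim
    (fun a ha => (⟨a.1, a.2, fun h => ha (Subtype.ext h)⟩ : ∃ u, u ∈ π.ker ∧ u ≠ 0))
  obtain ⟨i, hui⟩ : ∃ i, ρ i u ≠ 0 := by
    by_contra! h
    exact hu0 (hinj u (hK u hu) 0 (fun i _ => h i))
  obtain ⟨j, hij, huj⟩ := hpair u hu i hui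
  by_cases hall : ∀ x ∈ π.ker, ∀ l, l ≠ i → l ≠ j → ρ l x = 0
  · left
    obtain ⟨n, h1, h2, h4, h5⟩ :=
      cyclic_case p hp (xgen p) d ρ hd hρ hinj π.ker hfin hK hker i j hij hall
    exact ⟨n, i, j, hij, h1, h2, h4, h5⟩
  · right
    push Not at hall
    obtain ⟨v, hv, l, hli, hlj, hvl⟩ := hall
    obtain ⟨m, hlm, hvm⟩ := hpair v hv l hvl
    by_cases hmi : m = i
    · subst hmi
      obtain ⟨a, b, c, e, f⟩ := klein_case p hp (xgen p) d ρ hd hρ hinj π.ker hK h3 m j l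
        hij hli.symm hlj.symm u v hu hv hui huj hvm hvl
      exact ⟨m, j, l, hij, hli.symm, hlj.symm, a, b, c, e, f⟩
    by_cases hmj : m = j
    · subst hmj
      obtain ⟨a, b, c, e, f⟩ := klein_case p hp (xgen p) d ρ hd hρ hinj π.ker hK h3 m i l
        hij.symm hlj.symm hli.symm u v hu hv huj hui hvm hvl
      exact ⟨m, i, l, hij.symm, hlj.symm, hli.symm, a, b, c, e, f⟩
    exfalso
    have hul := h3 u hu i j l hij hli.symm hlj.symm hui huj
    have hvi := h3 v hv l m i hlm hli hmi hvl hvm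
    have hvj := h3 v hv l m j hlm hlj hmj hvl hvm
    have := h3 (u + v) (π.ker.add_mem hu hv) i j l hij hli.symm hlj.symm
      (by rw [map_add, hvi, add_zero]; exact hui) (by rw [map_add, hvj, add_zero]; exact huj)
    rw [map_add, hul, zero_add] at this
    exact hvl this
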